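/- Let X = Y ∪ Z with Y ⊂ {x_0=...=x_{l-1}=0}, Z ⊂ {x_{l+1}=...=x_n=0}, meeting in the single coordinate point. For m at least the Castelnuovo–Mumford regularity, the m-th state polytope satisfies P_m(I_X) = P_m(I_Y ∩ k[x_l,...,x_n]) + P_m(I_Z ∩ k[x_0,...,x_l]) + τ, where the sum is Minkowski sum, τ = Σ_{x^α ∈ T_m} α is the sum of exponent vectors of degree-m monomials in T = ⟨x_0,...,x_{l-1}⟩⟨x_{l+1},...,x_n⟩, and each factor state polytope is regarded as a polytope in the corresponding coordinate subspace of ℝ^{n+1}. -/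

import Mathlib

open MvPolynomial Finset
open scoped MonomialOrder Pointwise

/-- The leading exponent (exponent of the leading monomial) of a polynomial
with respect to a monomial order. -/
noncomputable def leadExp {k : Type*} [Field k] {N : ℕ}
    (mo : MonomialOrder (Fin N)) (f : MvPolynomial (Fin N) k) :
    Fin N →₀ ℕ :=
  mo.toSyn.symm (f.support.sup mo.toSyn)

/-- The ideal of `k[x_0,…,x_{N-1}]` generated by the leading monomials of the elements of
`I ∩ k[x_i : i ∈ s]`, i.e. of the nonzero elements of `I` all of whose variables lie in `s`.
This is the ideal generated by the initial ideal (computed in the smaller polynomial ring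
`k[x_i : i ∈ s]` with the restricted monomial order) of the intersection of `I` with that
smaller polynomial ring. -/
noncomputable def restInitialIdeal {k : Type*} [Field k] {N : ℕ} (mo : MonomialOrder (Fin N))
    (I : Ideal (MvPolynomial (Fin N) k)) (s : Set (Fin N)) :
    Ideal (MvPolynomial (Fin N) k) :=
  Ideal.span { g | ∃ f ∈ I, f ≠ 0 ∧ ↑f.vars ⊆ s ∧ g = monomial (leadExp mo f) (1 : k) }

/-- The initial ideal of `I` with respect to a monomial order: the ideal generated by the
leading monomials of the nonzero elements of `I`. -/
noncomputable def initialIdeal {k : Type*} [Field k] {N : ℕ} (mo : MonomialOrder (Fin N))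
    (I : Ideal (MvPolynomial (Fin N) k)) : Ideal (MvPolynomial (Fin N) k) :=
  restInitialIdeal mo I Set.univ

/-- The coordinate point whose coordinates all vanish except the `c`-th, which equals `1`. -/
def coordPt (k : Type*) [Field k] {N : ℕ} (c : ℕ) : Fin N → k :=
  fun j => if (j : ℕ) = c then 1 else 0

/-- The sum of the exponent vectors of the degree-`m` monomials of `J` in the variables
`x_i, i ∈ s`, as a point of `ℝ^N`. -/
noncomputable def statePoint {k : Type*} [Field k] {N : ℕ}
    (J : Ideal (MvPolynomial (Fin N) k)) (s : Set (Fin N)) (m : ℕ) : Fin N → ℝ :=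
  fun i => ∑ᶠ α ∈ {α : Fin N →₀ ℕ | (∑ j, α j) = m ∧ ↑α.support ⊆ s ∧
    monomial α (1 : k) ∈ J}, ((α i : ℝ))

/-- The `m`-th state polytope of `I ∩ k[x_i : i ∈ s]`, regarded as a polytope in the
corresponding coordinate subspace of `ℝ^N`: the convex hull, over all monomial orders `≺`,
of the sums of the exponent vectors of the degree-`m` monomials of the initial ideal
`in_≺(I ∩ k[x_i : i ∈ s])`. -/
noncomputable def statePolytope {k : Type*} [Field k] {N : ℕ}
    (I : Ideal (MvPolynomial (Fin N) k)) (s : Set (Fin N)) (m : ℕ) : Set (Fin N → ℝ) :=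
  convexHull ℝ {p | ∃ mo : MonomialOrder.{0,0} (Fin N),
    p = statePoint (restInitialIdeal mo I s) s m}

/-- The additive map used to glue two monomial orders. -/
noncomputable def gluHom {N : ℕ} (m1 m2 : MonomialOrder.{0,0} (Fin N)) (f g : Fin N → Fin N) :
    (Fin N →₀ ℕ) →+ Lex (m1.syn × m2.syn) where
  toFun α := toLex (m1.toSyn (α.mapDomain f), m2.toSyn (α.mapDomain g))
  map_zero' := by simp
  map_add' a b := by simp [Finsupp.mapDomain_add]; rfl

/-- The glued monomial order. -/
noncomputable def gluOrd {N : ℕ} (m1 m2 : MonomialOrder.{0,0} (Fin N)) (f g : Fin N → Fin N)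
    (h : Function.Injective (gluHom m1 m2 f g)) : MonomialOrder.{0,0} (Fin N) where
  syn := AddMonoidHom.mrange (gluHom m1 m2 f g)
  addCommMonoidSyn := inferInstance
  linearOrderSyn := inferInstance
  isOrderedAddMonoid_syn := inferInstance
  wellFoundedLT_syn := inferInstance
  toSyn := AddEquiv.ofBijective (gluHom m1 m2 f g).mrangeRestrict
    ⟨fun a b hab => h (congrArg Subtype.val hab), AddMonoidHom.mrangeRestrict_surjective _⟩
  toSyn_monotone := by
    intro a b hab
    obtain ⟨c, rfl⟩ := exists_add_of_le hab
    change gluHom m1 m2 f g a ≤ gluHom m1 m2 f g (a + c)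
    rw [map_add]
    refine le_add_of_nonneg_right ?_
    refine Prod.Lex.toLex_mono ⟨?_, ?_⟩
    · simp
    · simp

lemma gluOrd_le {N : ℕ} (m1 m2 : MonomialOrder.{0,0} (Fin N)) (f g : Fin N → Fin N)
    (h : Function.Injective (gluHom m1 m2 f g)) (a b : Fin N →₀ ℕ) :
    (gluOrd m1 m2 f g h).toSyn a ≤ (gluOrd m1 m2 f g h).toSyn b ↔
      m1.toSyn (a.mapDomain f) < m1.toSyn (b.mapDomain f) ∨
      (a.mapDomain f = b.mapDomain f ∧ m2.toSyn (a.mapDomain g) ≤ m2.toSyn (b.mapDomain g)) := by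
  change gluHom m1 m2 f g a ≤ gluHom m1 m2 f g b ↔ _
  change toLex _ ≤ toLex _ ↔ _
  rw [Prod.Lex.toLex_le_toLex]
  simp

/-- `α` is the leading exponent of a homogeneous element of `I` in the variables `s`. -/
def IsLead {k : Type*} [Field k] {N : ℕ} (mo : MonomialOrder.{0,0} (Fin N))
    (I : Ideal (MvPolynomial (Fin N) k)) (s : Set (Fin N)) (α : Fin N →₀ ℕ) : Prop :=
  ∃ f ∈ I, α ∈ f.support ∧ ∀ β ∈ f.support, (∑ j, β j) = ∑ j, α j ∧ (↑β.support : Set (Fin N)) ⊆ s ∧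
    mo.toSyn β ≤ mo.toSyn α

lemma isLead_congr {k : Type*} [Field k] {N : ℕ} (mo mo' : MonomialOrder.{0,0} (Fin N))
    (I : Ideal (MvPolynomial (Fin N) k)) (s : Set (Fin N))
    (h : ∀ α β : Fin N →₀ ℕ, (∑ j, β j) = ∑ j, α j → (↑β.support : Set (Fin N)) ⊆ s →
      (↑α.support : Set (Fin N)) ⊆ s → (mo.toSyn β ≤ mo.toSyn α ↔ mo'.toSyn β ≤ mo'.toSyn α))
    (α : Fin N →₀ ℕ) : IsLead mo I s α ↔ IsLead mo' I s α := by
  refine exists_congr fun f => and_congr_right fun _ => and_congr_right fun ha => ?_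
  constructor
  · intro H β hβ
    obtain ⟨h1, h2, h3⟩ := H β hβ
    exact ⟨h1, h2, (h α β h1 h2 (H α ha).2.1).1 h3⟩
  · intro H β hβ
    obtain ⟨h1, h2, h3⟩ := H β hβ
    exact ⟨h1, h2, (h α β h1 h2 (H α ha).2.1).2 h3⟩

lemma leadExp_eq {k : Type*} [Field k] {N : ℕ} (mo : MonomialOrder.{0,0} (Fin N))
    (f : MvPolynomial (Fin N) k) (α : Fin N →₀ ℕ) (ha : α ∈ f.support)
    (h : ∀ β ∈ f.support, mo.toSyn β ≤ mo.toSyn α) : leadExp mo f = α := by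
  unfold leadExp
  rw [AddEquiv.symm_apply_eq]
  exact le_antisymm (Finset.sup_le h) (Finset.le_sup ha)

lemma leadExp_spec {k : Type*} [Field k] {N : ℕ} (mo : MonomialOrder.{0,0} (Fin N))
    (f : MvPolynomial (Fin N) k) (hf : f ≠ 0) : leadExp mo f ∈ f.support ∧
    ∀ β ∈ f.support, mo.toSyn β ≤ mo.toSyn (leadExp mo f) := by
  obtain ⟨α, ha, h⟩ := Finset.exists_max_image f.support mo.toSyn
    (MvPolynomial.support_nonempty.2 hf)
  rw [leadExp_eq mo f α ha h]
  exact ⟨ha, h⟩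

lemma vars_sub {k : Type*} [Field k] {N : ℕ} (f : MvPolynomial (Fin N) k) (s : Set (Fin N)) :
    (↑f.vars : Set (Fin N)) ⊆ s ↔ ∀ β ∈ f.support, (↑β.support : Set (Fin N)) ⊆ s := by
  constructor
  · intro h β hβ j hj
    exact h (Finset.mem_coe.2 (MvPolynomial.mem_vars_iff_mem_support j |>.2 ⟨β, hβ, hj⟩))
  · intro h j hj
    obtain ⟨β, hβ, hj⟩ := MvPolynomial.mem_vars_iff_mem_support j |>.1 (Finset.mem_coe.1 hj)
    exact h β hβ hj

lemma isLead_iff {k : Type*} [Field k] {N : ℕ} (mo : MonomialOrder.{0,0} (Fin N))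
    (I : Ideal (MvPolynomial (Fin N) k)) (s : Set (Fin N))
    (hI : ∀ f ∈ I, ∀ d : ℕ, homogeneousComponent d f ∈ I) (α : Fin N →₀ ℕ) :
    ((↑α.support : Set (Fin N)) ⊆ s ∧ monomial α (1 : k) ∈ restInitialIdeal mo I s) ↔
      IsLead mo I s α := by
  constructor
  · rintro ⟨hs, h⟩
    have h2 : {g | ∃ f ∈ I, f ≠ 0 ∧ ↑f.vars ⊆ s ∧ g = monomial (leadExp mo f) (1 : k)} =
        (fun s => monomial s (1 : k)) ''
          {β | ∃ f ∈ I, f ≠ 0 ∧ ↑f.vars ⊆ s ∧ β = leadExp mo f} := by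
      ext g
      constructor
      · rintro ⟨f, h1, h2, h3, rfl⟩
        exact ⟨_, ⟨f, h1, h2, h3, rfl⟩, rfl⟩
      · rintro ⟨_, ⟨f, h1, h2, h3, rfl⟩, rfl⟩
        exact ⟨f, h1, h2, h3, rfl⟩
    rw [restInitialIdeal, h2, MvPolynomial.mem_ideal_span_monomial_image] at h
    obtain ⟨_, ⟨f, hf, hf0, hv, rfl⟩, hle⟩ := h α (by classical simp [MvPolynomial.support_monomial])
    obtain ⟨γ, hγ⟩ := exists_add_of_le hle
    obtain ⟨hL, hmax⟩ := leadExp_spec mo f hf0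
    rw [vars_sub] at hv
    refine ⟨homogeneousComponent (∑ j, α j) (monomial γ 1 * f), hI _ (I.mul_mem_left _ hf) _,
      ?_, ?_⟩
    · rw [MvPolynomial.mem_support_iff, MvPolynomial.coeff_homogeneousComponent,
        if_pos (Finsupp.degree_eq_sum α), hγ, add_comm, MvPolynomial.coeff_monomial_mul]
      simpa using hL
    · intro β hβ
      rw [MvPolynomial.mem_support_iff, MvPolynomial.coeff_homogeneousComponent] at hβ
      split_ifs at hβ with hd
      · rw [MvPolynomial.coeff_monomial_mul'] at hβ
        split_ifs at hβ with hg
        · obtain ⟨δ, rfl⟩ := exists_add_of_le hg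
          have hδ : δ ∈ f.support := by simpa using hβ
          refine ⟨by rw [← hd, Finsupp.degree_eq_sum], ?_, ?_⟩
          · intro j hj
            by_cases hj2 : j ∈ δ.support
            · exact hv _ hδ hj2
            · apply hs
              rw [hγ]
              simp at hj hj2 ⊢
              omega
          · rw [hγ, map_add, map_add, add_comm]
            exact add_le_add_left (hmax δ hδ) _
        · exact absurd rfl hβ
      · exact absurd rfl hβ
  · rintro ⟨f, hf, ha, h⟩
    refine ⟨(h α ha).2.1, Ideal.subset_span ⟨f, hf, ?_, ?_, ?_⟩⟩
    · rintro rfl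
      simp at ha
    · rw [vars_sub]
      exact fun β hβ => (h β hβ).2.1
    · rw [leadExp_eq mo f α ha fun β hβ => (h β hβ).2.2]

lemma exists_ne_of_vanish {k : Type*} [Field k] {N : ℕ} (c : Fin N)
    (f : MvPolynomial (Fin N) k) (d : ℕ) (h0 : eval (coordPt k (c : ℕ)) f = 0)
    (hd : ∀ β ∈ f.support, (∑ j, β j) = d) : ∀ β ∈ f.support, ∃ j, j ≠ c ∧ β j ≠ 0 := by
  by_contra! hcon
  obtain ⟨β, hβ, h⟩ := hcon
  rw [MvPolynomial.eval_eq'] at h0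
  rw [Finset.sum_eq_single_of_mem β hβ] at h0
  · rw [Finset.prod_eq_one, mul_one] at h0
    · exact (MvPolynomial.mem_support_iff.1 hβ) h0
    · intro j _
      by_cases hj : j = c
      · simp [coordPt, hj]
      · simp [h j hj]
  · intro γ hγ hne
    have : ∃ j, j ≠ c ∧ γ j ≠ 0 := by
      by_contra! hc
      apply hne
      have e1 := hd γ hγ
      have e2 := hd β hβ
      rw [Finset.sum_eq_single c (fun j _ hj => hc j hj) (by simp)] at e1
      rw [Finset.sum_eq_single c (fun j _ hj => h j hj) (by simp)] at e2
      ext j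
      by_cases hj : j = c
      · rw [hj, e1, e2]
      · rw [hc j hj, h j hj]
    obtain ⟨j, hj, hj2⟩ := this
    apply mul_eq_zero_of_right
    apply Finset.prod_eq_zero (Finset.mem_univ j)
    have : (j : ℕ) ≠ c := fun h => hj (Fin.ext h)
    simp [coordPt, this, hj2]

lemma mem_of_support {k : Type*} [Field k] {N : ℕ} (A : Set (Fin N))
    (I : Ideal (MvPolynomial (Fin N) k)) (hI : ∀ j, j ∉ A → (X j : MvPolynomial (Fin N) k) ∈ I)
    (f : MvPolynomial (Fin N) k) (h : ∀ β ∈ f.support, ∃ j, j ∉ A ∧ β j ≠ 0) : f ∈ I := by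
  have : f ∈ Ideal.span (MvPolynomial.X '' Aᶜ : Set (MvPolynomial (Fin N) k)) := by
    rw [MvPolynomial.mem_ideal_span_X_image]
    exact h
  refine Ideal.span_le.2 ?_ this
  rintro _ ⟨j, hj, rfl⟩
  exact hI j hj

lemma isLead_of_inf {k : Type*} [Field k] {N : ℕ} (mo : MonomialOrder.{0,0} (Fin N)) (A : Set (Fin N))
    (I J : Ideal (MvPolynomial (Fin N) k)) (hI : ∀ j, j ∉ A → (X j : MvPolynomial (Fin N) k) ∈ I)
    (hJ : J ≤ I) (α : Fin N →₀ ℕ) (hα : (↑α.support : Set (Fin N)) ⊆ A)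
    (h : IsLead mo J Set.univ α) : IsLead mo I A α := by
  classical
  obtain ⟨f, hf, ha, h⟩ := h
  let p : (Fin N →₀ ℕ) → Prop := fun β => (↑β.support : Set (Fin N)) ⊆ A
  let g : MvPolynomial (Fin N) k := ∑ β ∈ f.support with p β, monomial β (coeff β f)
  have hg : ∀ β, coeff β g = if p β then coeff β f else 0 := by
    intro β
    simp only [g, MvPolynomial.coeff_sum, MvPolynomial.coeff_monomial]
    rw [Finset.sum_ite_eq' ]
    simp only [Finset.mem_filter, MvPolynomial.mem_support_iff]
    by_cases h1 : p β <;> by_cases h2 : coeff β f = 0 <;> simp [h1, h2]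
  have hgI : f - g ∈ I := by
    apply mem_of_support A I hI
    intro β hβ
    rw [MvPolynomial.mem_support_iff, MvPolynomial.coeff_sub, hg] at hβ
    by_cases hp : p β
    · simp [hp] at hβ
    · obtain ⟨j, h1, h2⟩ := Set.not_subset.1 hp
      exact ⟨j, h2, by simpa using h1⟩
  refine ⟨g, ?_, ?_, ?_⟩
  · have := I.sub_mem (hJ hf) hgI
    simpa using this
  · rw [MvPolynomial.mem_support_iff, hg, if_pos hα]
    simpa using ha
  · intro β hβ
    rw [MvPolynomial.mem_support_iff, hg] at hβ
    by_cases hp : p β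
    · rw [if_pos hp] at hβ
      have := h β (by simpa using hβ)
      exact ⟨this.1, hp, this.2.2⟩
    · simp [hp] at hβ

lemma isLead_inf {k : Type*} [Field k] {N : ℕ} (mo : MonomialOrder.{0,0} (Fin N)) (A B : Set (Fin N))
    (c : Fin N) (hAB : ∀ j, j ∈ A → j ≠ c → j ∉ B)
    (I J : Ideal (MvPolynomial (Fin N) k))
    (hJ : ∀ j, j ∉ B → (X j : MvPolynomial (Fin N) k) ∈ J)
    (h0 : ∀ f ∈ I, eval (coordPt k (c : ℕ)) f = 0) (α : Fin N →₀ ℕ)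
    (h : IsLead mo I A α) : (∃ j, j ∉ B ∧ α j ≠ 0) ∧ IsLead mo (I ⊓ J) Set.univ α := by
  obtain ⟨f, hf, ha, h⟩ := h
  have key : ∀ β ∈ f.support, ∃ j, j ∉ B ∧ β j ≠ 0 := by
    intro β hβ
    obtain ⟨j, h1, h2⟩ := exists_ne_of_vanish c f _ (h0 f hf) (fun β hβ => (h β hβ).1) β hβ
    exact ⟨j, hAB j ((h β hβ).2.1 (by simpa using h2)) h1, h2⟩
  exact ⟨key α ha, f, ⟨hf, mem_of_support B J hJ f key⟩, ha,
    fun β hβ => ⟨(h β hβ).1, Set.subset_univ _, (h β hβ).2.2⟩⟩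

lemma isLead_T {k : Type*} [Field k] {N : ℕ} (mo : MonomialOrder.{0,0} (Fin N)) (A B : Set (Fin N))
    (I J : Ideal (MvPolynomial (Fin N) k))
    (hI : ∀ j, j ∉ A → (X j : MvPolynomial (Fin N) k) ∈ I)
    (hJ : ∀ j, j ∉ B → (X j : MvPolynomial (Fin N) k) ∈ J) (α : Fin N →₀ ℕ)
    (h1 : ∃ j, j ∉ A ∧ α j ≠ 0) (h2 : ∃ j, j ∉ B ∧ α j ≠ 0) :
    IsLead mo (I ⊓ J) Set.univ α := by
  classical
  have hs : (monomial α (1 : k)).support = {α} := by simp [MvPolynomial.support_monomial]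
  refine ⟨monomial α 1, ⟨mem_of_support A I hI _ ?_, mem_of_support B J hJ _ ?_⟩, ?_, ?_⟩ <;>
    rw [hs] <;> simp
  · exact h1
  · exact h2

lemma mem_T {k : Type*} [Field k] {N : ℕ} (S S' : Set (Fin N)) (hSS : Disjoint S S')
    (α : Fin N →₀ ℕ) :
    monomial α (1 : k) ∈ Ideal.span ((fun j => (X j : MvPolynomial (Fin N) k)) '' S) *
      Ideal.span ((fun j => (X j : MvPolynomial (Fin N) k)) '' S') ↔
      (∃ j ∈ S, α j ≠ 0) ∧ (∃ j ∈ S', α j ≠ 0) := by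
  classical
  have hs : (monomial α (1 : k)).support = {α} := by simp [MvPolynomial.support_monomial]
  constructor
  · intro h
    have h1 := MvPolynomial.mem_ideal_span_X_image.1 (Ideal.mul_le_right h)
    have h2 := MvPolynomial.mem_ideal_span_X_image.1 (Ideal.mul_le_left h)
    rw [hs] at h1 h2
    exact ⟨h2 α (by simp), h1 α (by simp)⟩
  · rintro ⟨⟨i, hi, hi0⟩, ⟨j, hj, hj0⟩⟩
    have hij : i ≠ j := fun e => Set.disjoint_left.1 hSS hi (e ▸ hj)
    have hle : Finsupp.single i 1 + Finsupp.single j 1 ≤ α := by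
      intro t
      simp only [Finsupp.add_apply, Finsupp.single_apply]
      split_ifs with h1 h2 h2
      · exact absurd (h1.trans h2.symm) hij
      · subst h1; omega
      · subst h2; omega
      · omega
    obtain ⟨γ, rfl⟩ := exists_add_of_le hle
    have : monomial (Finsupp.single i 1 + Finsupp.single j 1 + γ) (1 : k) =
        monomial γ 1 * (X i * X j) := by
      simp only [MvPolynomial.X, MvPolynomial.monomial_mul, mul_one]
      rw [add_comm]
    rw [this]
    exact Ideal.mul_mem_left _ _ (Ideal.mul_mem_mul (Ideal.subset_span ⟨i, hi, rfl⟩)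
      (Ideal.subset_span ⟨j, hj, rfl⟩))

lemma finite_deg {N : ℕ} (m : ℕ) : {α : Fin N →₀ ℕ | (∑ j, α j) = m}.Finite := by
  refine (Set.finite_Iic (Finsupp.equivFunOnFinite.symm fun _ : Fin N => m)).subset ?_
  intro α hα j
  rw [← (show (∑ j, α j) = m from hα)]
  simpa using Finset.single_le_sum (f := fun j => α j) (fun _ _ => Nat.zero_le _) (Finset.mem_univ j)

lemma statePoint_lead {k : Type*} [Field k] {N : ℕ} (mo : MonomialOrder.{0,0} (Fin N))
    (I : Ideal (MvPolynomial (Fin N) k)) (s : Set (Fin N))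
    (hI : ∀ f ∈ I, ∀ d : ℕ, homogeneousComponent d f ∈ I) (m : ℕ) :
    statePoint (restInitialIdeal mo I s) s m =
      fun i => ∑ᶠ α ∈ {α : Fin N →₀ ℕ | (∑ j, α j) = m ∧ IsLead mo I s α}, ((α i : ℝ)) := by
  unfold statePoint
  simp_rw [isLead_iff mo I s hI]

lemma map_single {N : ℕ} (g : Fin N → Fin N) (α : Fin N →₀ ℕ) (s : Set (Fin N))
    (hg : ∀ j ∈ s, g j = j) (hα : (↑α.support : Set (Fin N)) ⊆ s) : α.mapDomain g = α := by
  conv_rhs => rw [← Finsupp.mapDomain_id (v := α)]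
  exact Finsupp.mapDomain_congr fun x hx => hg x (hα hx)

lemma map_const {N : ℕ} (g : Fin N → Fin N) (α : Fin N →₀ ℕ) (s : Set (Fin N)) (c : Fin N)
    (hg : ∀ j ∈ s, g j = c) (hα : (↑α.support : Set (Fin N)) ⊆ s) :
    α.mapDomain g = Finsupp.single c (∑ j, α j) := by
  rw [Finsupp.mapDomain_congr (g := fun _ => c) fun x hx => hg x (hα hx)]
  rw [Finsupp.mapDomain, Finsupp.sum_fintype _ _ (by simp)]
  exact (map_sum (Finsupp.singleAddHom c) (fun j => α j) Finset.univ).symm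

lemma exists_glue {N : ℕ} (c : Fin N) (m1 m2 : MonomialOrder.{0,0} (Fin N)) :
    ∃ mo : MonomialOrder.{0,0} (Fin N),
      (∀ α β : Fin N →₀ ℕ, (↑β.support : Set (Fin N)) ⊆ Set.Ici c →
        (↑α.support : Set (Fin N)) ⊆ Set.Ici c →
        (m1.toSyn β ≤ m1.toSyn α ↔ mo.toSyn β ≤ mo.toSyn α)) ∧
      (∀ α β : Fin N →₀ ℕ, (∑ j, β j) = ∑ j, α j → (↑β.support : Set (Fin N)) ⊆ Set.Iic c →
        (↑α.support : Set (Fin N)) ⊆ Set.Iic c →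
        (m2.toSyn β ≤ m2.toSyn α ↔ mo.toSyn β ≤ mo.toSyn α)) := by
  have inj : Function.Injective (gluHom m1 m2 (fun j => max j c) (fun j => min j c)) := by
    intro a b hab
    have h1 : m1.toSyn (a.mapDomain fun j => max j c) = m1.toSyn (b.mapDomain fun j => max j c) :=
      congrArg (fun x => (ofLex x).1) hab
    have h2 : m2.toSyn (a.mapDomain fun j => min j c) = m2.toSyn (b.mapDomain fun j => min j c) :=
      congrArg (fun x => (ofLex x).2) hab
    have h1 := m1.toSyn.injective h1
    have h2 := m2.toSyn.injective h2
    have e1 : ∀ (x : Fin N →₀ ℕ) (j : Fin N), c < j → (x.mapDomain fun j => max j c) j = x j := by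
      intro x j hj
      rw [Finsupp.mapDomain, Finsupp.sum_fintype _ _ (by simp), Finsupp.finsetSum_apply,
        Finset.sum_eq_single j]
      · simp [max_eq_left hj.le]
      · intro i _ hi
        rw [Finsupp.single_apply, if_neg]
        intro h
        rcases max_choice i c with h' | h' <;> rw [h'] at h
        · exact hi h
        · exact hj.ne h
      · simp
    have e2 : ∀ (x : Fin N →₀ ℕ) (j : Fin N), j < c → (x.mapDomain fun j => min j c) j = x j := by
      intro x j hj
      rw [Finsupp.mapDomain, Finsupp.sum_fintype _ _ (by simp), Finsupp.finsetSum_apply,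
        Finset.sum_eq_single j]
      · simp [min_eq_left hj.le]
      · intro i _ hi
        rw [Finsupp.single_apply, if_neg]
        intro h
        rcases min_choice i c with h' | h' <;> rw [h'] at h
        · exact hi h
        · exact hj.ne h.symm
      · simp
    have hne : ∀ j, j ≠ c → a j = b j := by
      intro j hj
      rcases lt_or_gt_of_ne hj with h | h
      · rw [← e2 a j h, h2, e2 b j h]
      · rw [← e1 a j h, h1, e1 b j h]
    have hd : ∑ j, a j = ∑ j, b j := by
      have := congrArg Finsupp.degree h1
      rw [Finsupp.degree_mapDomain, Finsupp.degree_mapDomain] at this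
      simpa [Finsupp.degree_eq_sum] using this
    ext j
    by_cases hj : j = c
    · subst hj
      rw [← Finset.add_sum_erase _ (fun j => a j) (Finset.mem_univ j),
        ← Finset.add_sum_erase _ (fun j => b j) (Finset.mem_univ j),
        Finset.sum_congr rfl (fun i hi => hne i (Finset.ne_of_mem_erase hi))] at hd
      exact Nat.add_right_cancel hd
    · exact hne j hj
  refine ⟨gluOrd m1 m2 _ _ inj, ?_, ?_⟩
  · intro α β hβ hα
    have hg : ∀ j ∈ Set.Ici c, max j c = j := fun j hj => max_eq_left hj
    have hg' : ∀ j ∈ Set.Ici c, min j c = c := fun j hj => min_eq_right hj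
    rw [gluOrd_le, map_single _ α _ hg hα, map_single _ β _ hg hβ, le_iff_lt_or_eq]
    constructor
    · rintro (h | h)
      · exact Or.inl h
      · have := m1.toSyn.injective h
        subst this
        exact Or.inr ⟨rfl, le_rfl⟩
    · rintro (h | h)
      · exact Or.inl h
      · exact Or.inr (by rw [h.1])
  · intro α β hd hβ hα
    have hg : ∀ j ∈ Set.Iic c, max j c = c := fun j hj => max_eq_right hj
    have hg' : ∀ j ∈ Set.Iic c, min j c = j := fun j hj => min_eq_left hj
    rw [gluOrd_le, map_const _ α _ c hg hα, map_const _ β _ c hg hβ, map_single _ α _ hg' hα,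
      map_single _ β _ hg' hβ, hd]
    simp

/-- for `X = Y ∪ Z` with `Y ⊆ {x_0 = ⋯ = x_{l-1} = 0}`,
`Z ⊆ {x_{l+1} = ⋯ = x_n = 0}` meeting in the single coordinate point, the `m`-th state
polytope satisfies the Minkowski sum decomposition
`P_m(I_X) = P_m(I_Y ∩ k[x_l,…,x_n]) + P_m(I_Z ∩ k[x_0,…,x_l]) + {τ}`,
where `τ` is the sum of the exponent vectors of the degree-`m` monomials of
`T = ⟨x_0,…,x_{l-1}⟩·⟨x_{l+1},…,x_n⟩`. -/
theorem state_polytope_decomposition {k : Type*} [Field k] (n l : ℕ) (hl : l ≤ n)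
    (IY IZ : Ideal (MvPolynomial (Fin (n + 1)) k))
    (hIYhom : ∀ f ∈ IY, ∀ d : ℕ, homogeneousComponent d f ∈ IY)
    (hIZhom : ∀ f ∈ IZ, ∀ d : ℕ, homogeneousComponent d f ∈ IZ)
    (hYsub : ∀ j : Fin (n + 1), (j : ℕ) < l → (X j : MvPolynomial (Fin (n + 1)) k) ∈ IY)
    (hZsub : ∀ j : Fin (n + 1), l < (j : ℕ) → (X j : MvPolynomial (Fin (n + 1)) k) ∈ IZ)
    (hYp : ∀ f ∈ IY, eval (coordPt k l) f = 0)
    (hZp : ∀ f ∈ IZ, eval (coordPt k l) f = 0)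
    (m : ℕ) :
    statePolytope (IY ⊓ IZ) Set.univ m =
      statePolytope IY {j : Fin (n + 1) | l ≤ (j : ℕ)} m +
      statePolytope IZ {j : Fin (n + 1) | (j : ℕ) ≤ l} m +
      {statePoint
        (Ideal.span ((fun j => (X j : MvPolynomial (Fin (n + 1)) k)) ''
            {j : Fin (n + 1) | (j : ℕ) < l}) *
          Ideal.span ((fun j => (X j : MvPolynomial (Fin (n + 1)) k)) ''
            {j : Fin (n + 1) | l < (j : ℕ)}))
        Set.univ m} := by
  
  classical
  let c : Fin (n + 1) := ⟨l, by omega⟩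
  have hA : {j : Fin (n + 1) | l ≤ (j : ℕ)} = Set.Ici c := by
    ext j; exact Iff.rfl
  have hB : {j : Fin (n + 1) | (j : ℕ) ≤ l} = Set.Iic c := by
    ext j; exact Iff.rfl
  have hYs : ∀ j, j ∉ Set.Ici c → (X j : MvPolynomial (Fin (n + 1)) k) ∈ IY := fun j hj =>
    hYsub j (not_le.1 hj)
  have hZs : ∀ j, j ∉ Set.Iic c → (X j : MvPolynomial (Fin (n + 1)) k) ∈ IZ := fun j hj =>
    hZsub j (not_le.1 hj)
  have hXhom : ∀ f ∈ IY ⊓ IZ, ∀ d : ℕ, homogeneousComponent d f ∈ IY ⊓ IZ := fun f hf d =>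
    ⟨hIYhom f hf.1 d, hIZhom f hf.2 d⟩
  rw [hA, hB]
  set τ := statePoint
        (Ideal.span ((fun j => (X j : MvPolynomial (Fin (n + 1)) k)) ''
            {j : Fin (n + 1) | (j : ℕ) < l}) *
          Ideal.span ((fun j => (X j : MvPolynomial (Fin (n + 1)) k)) ''
            {j : Fin (n + 1) | l < (j : ℕ)}))
        Set.univ m with hτ
  have hdis : Disjoint {j : Fin (n + 1) | (j : ℕ) < l} {j : Fin (n + 1) | l < (j : ℕ)} := by
    rw [Set.disjoint_left]
    intro j h1 h2
    simp only [Set.mem_ofPred_eq] at h1 h2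
    omega
  have hτ2 : τ = fun i => ∑ᶠ α ∈ {α : Fin (n + 1) →₀ ℕ | (∑ j, α j) = m ∧
      ((∃ j, j ∉ Set.Ici c ∧ α j ≠ 0) ∧ (∃ j, j ∉ Set.Iic c ∧ α j ≠ 0))}, ((α i : ℝ)) := by
    rw [hτ]
    unfold statePoint
    simp_rw [mem_T _ _ hdis]
    funext i
    refine congrArg (fun S : Set (Fin (n + 1) →₀ ℕ) => ∑ᶠ α ∈ S, ((α i : ℝ))) ?_
    ext α
    simp [c, Fin.lt_def]
  have key : ∀ mo : MonomialOrder.{0,0} (Fin (n + 1)),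
      statePoint (restInitialIdeal mo (IY ⊓ IZ) Set.univ) Set.univ m =
        statePoint (restInitialIdeal mo IY (Set.Ici c)) (Set.Ici c) m +
        statePoint (restInitialIdeal mo IZ (Set.Iic c)) (Set.Iic c) m + τ := by
    intro mo
    rw [statePoint_lead mo _ _ hXhom, statePoint_lead mo _ _ hIYhom, statePoint_lead mo _ _ hIZhom,
      hτ2]
    have hYl : ∀ α, IsLead mo IY (Set.Ici c) α →
        (∃ j, j ∉ Set.Iic c ∧ α j ≠ 0) ∧ IsLead mo (IY ⊓ IZ) Set.univ α := fun α h =>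
      isLead_inf mo (Set.Ici c) (Set.Iic c) c
        (fun j h1 h2 h3 => h2 (le_antisymm h3 h1)) IY IZ hZs hYp α h
    have hZl : ∀ α, IsLead mo IZ (Set.Iic c) α →
        (∃ j, j ∉ Set.Ici c ∧ α j ≠ 0) ∧ IsLead mo (IY ⊓ IZ) Set.univ α := fun α h => by
      rw [inf_comm]
      exact isLead_inf mo (Set.Iic c) (Set.Ici c) c
        (fun j h1 h2 h3 => h2 (le_antisymm h1 h3)) IZ IY hYs hZp α h
    have hsupp : ∀ (I : Ideal (MvPolynomial (Fin (n + 1)) k)) (s : Set (Fin (n + 1))) α,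
        IsLead mo I s α → ¬ ∃ j, j ∉ s ∧ α j ≠ 0 := by
      rintro I s α ⟨f, _, ha, h⟩ ⟨j, hj, hj0⟩
      exact hj ((h α ha).2.1 (by simpa using hj0))
    have hnot : ∀ (s : Set (Fin (n + 1))) (α : Fin (n + 1) →₀ ℕ),
        (¬ ∃ j, j ∉ s ∧ α j ≠ 0) → (↑α.support : Set (Fin (n + 1))) ⊆ s := by
      intro s α h j hj
      by_contra hjs
      exact h ⟨j, hjs, by simpa using hj⟩
    have hset : {α : Fin (n + 1) →₀ ℕ | (∑ j, α j) = m ∧ IsLead mo (IY ⊓ IZ) Set.univ α} =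
        ({α | (∑ j, α j) = m ∧ IsLead mo IY (Set.Ici c) α} ∪
          {α | (∑ j, α j) = m ∧ IsLead mo IZ (Set.Iic c) α}) ∪
        {α | (∑ j, α j) = m ∧
          ((∃ j, j ∉ Set.Ici c ∧ α j ≠ 0) ∧ (∃ j, j ∉ Set.Iic c ∧ α j ≠ 0))} := by
      ext α
      constructor
      · rintro ⟨h1, h2⟩
        by_cases ha : ∃ j, j ∉ Set.Ici c ∧ α j ≠ 0
        · by_cases hb : ∃ j, j ∉ Set.Iic c ∧ α j ≠ 0
          · exact Or.inr ⟨h1, ha, hb⟩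
          · exact Or.inl (Or.inr ⟨h1, isLead_of_inf mo _ _ _ hZs inf_le_right α (hnot _ _ hb) h2⟩)
        · exact Or.inl (Or.inl ⟨h1, isLead_of_inf mo _ _ _ hYs inf_le_left α (hnot _ _ ha) h2⟩)
      · rintro ((⟨h1, h2⟩ | ⟨h1, h2⟩) | ⟨h1, h2, h3⟩)
        · exact ⟨h1, (hYl α h2).2⟩
        · exact ⟨h1, (hZl α h2).2⟩
        · exact ⟨h1, isLead_T mo _ _ _ _ hYs hZs α h2 h3⟩
    funext i
    simp only [Pi.add_apply]
    have fin : ∀ p : (Fin (n + 1) →₀ ℕ) → Prop, {α | (∑ j, α j) = m ∧ p α}.Finite := fun p =>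
      (finite_deg m).subset fun α h => h.1
    rw [hset, finsum_mem_union _ ((fin _).union (fin _)) (fin _),
      finsum_mem_union _ (fin _) (fin _)]
    · rw [Set.disjoint_left]
      rintro α ⟨_, h1⟩ ⟨_, h2⟩
      exact hsupp _ _ α h1 (hZl α h2).1
    · rw [Set.disjoint_left]
      rintro α (⟨_, h1⟩ | ⟨_, h1⟩) ⟨_, h2, h3⟩
      · exact hsupp _ _ α h1 h2
      · exact hsupp _ _ α h1 h3
  unfold statePolytope
  rw [← convexHull_add, ← convexHull_singleton (𝕜 := ℝ) τ, ← convexHull_add]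
  congr 1
  ext p
  constructor
  · rintro ⟨mo, rfl⟩
    rw [key mo]
    exact Set.add_mem_add (Set.add_mem_add ⟨mo, rfl⟩ ⟨mo, rfl⟩) rfl
  · rintro ⟨_, ⟨_, ⟨m1, rfl⟩, _, ⟨m2, rfl⟩, rfl⟩, _, rfl, rfl⟩
    obtain ⟨mo, h1, h2⟩ := exists_glue c m1 m2
    refine ⟨mo, ?_⟩
    rw [key mo]
    simp only [statePoint_lead _ _ _ hIYhom, statePoint_lead _ _ _ hIZhom]
    simp_rw [isLead_congr m1 mo IY (Set.Ici c) (fun α β _ => h1 α β),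
      isLead_congr m2 mo IZ (Set.Iic c) h2]
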